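/- arXiv:0705.1220 — 7 statements merged into one kernel-verified Lean document; each statement's English description precedes it below -/
import Mathlib

section
/- Let q ≥ 1 and n ≥ 1 be natural numbers, and suppose there exists a natural number ℓ with n ≤ 2^ℓ and 2^ℓ · (q + 1) ≤ 2^q. Then W q n 0, i.e., the questioner has a strategy which identifies x within q questions when at most one lie is allowed; in particular q₁(n) ≤ q. -/
/-- `W j a b` : the questioner can force a win within `j` questions from
state `(a, b)` (a = candidates fitting all answers, b = candidates fitting
all but exactly one answer) in Ulam's liar game with one lie. -/
def W : ℕ → ℕ → ℕ → Prop
  | 0, a, b => a + b ≤ 1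
  | (j+1), a, b => ∃ a₁ a₂ b₁ b₂ : ℕ, a₁ + a₂ = a ∧ b₁ + b₂ = b ∧
      W j a₁ (b₁ + a₂) ∧ W j a₂ (b₂ + a₁)

/-- Winning states are closed under passing to fewer candidates. -/
theorem W_mono {j a b a' b' : ℕ} (ha : a' ≤ a) (hb : b' ≤ b) (h : W j a b) : W j a' b' := by
  induction j generalizing a b a' b' with
  | zero =>
    simp only [W] at h ⊢
    omega
  | succ j ih =>
    obtain ⟨a₁, a₂, b₁, b₂, rfl, rfl, h₁, h₂⟩ := h
    exact ⟨min a' a₁, a' - min a' a₁, min b' b₁, b' - min b' b₁, by omega, by omega,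
      ih (by omega) (by omega) h₁, ih (by omega) (by omega) h₂⟩

/-- With no lie left, bisection handles up to `2 ^ j` candidates. -/
theorem W_zero_left {j b : ℕ} (hb : b ≤ 2 ^ j) : W j 0 b := by
  induction j generalizing b with
  | zero => simpa [W] using hb
  | succ j ih =>
    rw [pow_succ] at hb
    exact ⟨0, 0, b / 2, b - b / 2, by omega, by omega, ih (by omega), ih (by omega)⟩

/-- The volume bound suffices when a single candidate fits all the answers. -/
theorem W_one_left {j b : ℕ} (hb : j + 1 + b ≤ 2 ^ j) : W j 1 b := by
  induction j generalizing b with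
  | zero =>
    simp only [W]
    omega
  | succ j ih =>
    have hj : j < 2 ^ j := Nat.lt_two_pow_self
    rw [pow_succ] at hb
    exact ⟨1, 0, min b (2 ^ j - j - 1), b - min b (2 ^ j - j - 1), by omega, by omega,
      ih (by omega), W_zero_left (by omega)⟩

/-- Halving both classes of candidates `l` times leads from `(2 ^ l, k * 2 ^ l)` to
`(1, k + l)`. -/
theorem W_two_pow {m l k : ℕ} (h : m + 1 + (k + l) ≤ 2 ^ m) :
    W (m + l) (2 ^ l) (k * 2 ^ l) := by
  induction l generalizing k with
  | zero => simpa using W_one_left h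
  | succ l ih =>
    have hw : W (m + l) (2 ^ l) (k * 2 ^ l + 2 ^ l) := by
      simpa only [add_mul, one_mul] using ih (k := k + 1) (by omega)
    exact ⟨2 ^ l, 2 ^ l, k * 2 ^ l, k * 2 ^ l, by ring, by ring, hw, hw⟩

theorem ulam_upper_bound (q n : ℕ) (hq : 1 ≤ q) (hn : 1 ≤ n)
    (h : ∃ ℓ : ℕ, n ≤ 2 ^ ℓ ∧ 2 ^ ℓ * (q + 1) ≤ 2 ^ q) :
    W q n 0 := by
  obtain ⟨l, hnl, hl⟩ := h
  have hlq : l ≤ q := (Nat.pow_le_pow_iff_right one_lt_two).1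
    ((Nat.le_mul_of_pos_right _ q.succ_pos).trans hl)
  obtain ⟨m, rfl⟩ := Nat.exists_eq_add_of_le' hlq
  have hm : m + l + 1 ≤ 2 ^ m := by
    rw [pow_add, mul_comm (2 ^ m)] at hl
    exact Nat.le_of_mul_le_mul_left hl (by positivity)
  exact W_mono hnl (Nat.zero_le _) (W_two_pow (k := 0) (by omega))
end

section
/- Let q ≥ 1 and n be natural numbers with n · q > 2^(q−1). Then ¬ W (q−1) n 0, i.e., the questioner does not have a strategy which determines x within q − 1 questions. -/
/-- The volume bound: a state that can be won within `j` questions has weight at most `2 ^ j`. -/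
theorem W.weight_le {j a b : ℕ} (h : W j a b) : a * (j + 1) + b ≤ 2 ^ j := by
  induction j generalizing a b with
  | zero => simpa [W] using h
  | succ j ih =>
    obtain ⟨a₁, a₂, b₁, b₂, rfl, rfl, hyes, hno⟩ := h
    have := ih hyes
    have := ih hno
    rw [pow_succ]
    linarith

theorem ulam_lower_bound (q n : ℕ) (hq : 1 ≤ q) (h : n * q > 2 ^ (q - 1)) :
    ¬ W (q - 1) n 0 := by
  intro hW
  have hle := hW.weight_le
  rw [Nat.sub_add_cancel hq] at hle
  omega
end

section
/- (Pelc, even case) Let n ≥ 2 be an even natural number. Then the least natural number q with W q n 0 equals the least natural number q satisfying n · (q + 1) ≤ 2^q. -/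
theorem W.mono_right {j a b c : ℕ} (h : W j a b) (hc : c ≤ b) : W j a c := by
  induction j generalizing a b c with
  | zero => simp only [W] at h ⊢; omega
  | succ j ih =>
    obtain ⟨a₁, a₂, b₁, b₂, ha, hb, h₁, h₂⟩ := h
    exact ⟨a₁, a₂, min b₁ c, c - min b₁ c, ha, by omega, ih h₁ (by omega), ih h₂ (by omega)⟩

theorem mul_add_three_le_two_pow {j : ℕ} (hj : 4 ≤ j) : j * (j + 3) ≤ 2 ^ (j + 1) := by
  induction j, hj using Nat.le_induction with
  | base => norm_num
  | succ j hj ih => rw [pow_succ]; nlinarith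

theorem odd_weight_le {j a b : ℕ} (ha : Odd a) (hab : a ≤ b + 1) (hb : b < j)
    (h : a * (j + 2) + b ≤ 2 ^ (j + 1)) : a * (j + 2) + j ≤ 2 ^ (j + 1) := by
  rcases le_or_gt 4 j with hj | hj
  · have := mul_add_three_le_two_pow hj
    have : a * (j + 2) ≤ j * (j + 2) := Nat.mul_le_mul_right _ (by omega)
    nlinarith
  · obtain ⟨k, rfl⟩ := ha
    interval_cases j <;> norm_num at h ⊢ <;> omega

/-- The volume bound is sufficient for states with `a ≤ b + 1`. -/
theorem W.of_weight_le {j a b : ℕ} (hab : a ≤ b + 1) (h : a * (j + 1) + b ≤ 2 ^ j) :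
    W j a b := by
  induction j generalizing a b with
  | zero => simpa [W] using h
  | succ j ih =>
    rcases Nat.even_or_odd a with ⟨k, rfl⟩ | ha
    · refine ⟨k, k, b / 2, b - b / 2, rfl, by omega, ih (by omega) ?_, ih (by omega) ?_⟩ <;>
      · rw [pow_succ] at h
        ring_nf at h ⊢
        omega
    · suffices H : ∀ c, j ≤ c → a ≤ c + 1 → a * (j + 2) + c ≤ 2 ^ (j + 1) → W (j + 1) a c by
        rcases le_or_gt j b with hb | hb
        · exact H b hb hab h
        · exact (H j le_rfl (by omega) (odd_weight_le ha hab hb h)).mono_right hb.le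
      intro c hjc hac hc
      obtain ⟨k, rfl⟩ := ha
      refine ⟨k + 1, k, (c - j) / 2, c - (c - j) / 2, by omega, by omega,
        ih (by omega) ?_, ih (by omega) ?_⟩ <;>
      · rw [pow_succ] at hc
        ring_nf at hc ⊢
        omega

theorem W_zero_iff_of_even {q n : ℕ} (hn : Even n) : W q n 0 ↔ n * (q + 1) ≤ 2 ^ q := by
  refine ⟨W.weight_le, fun h => ?_⟩
  obtain ⟨m, rfl⟩ := hn
  cases q with
  | zero => exact W.of_weight_le (by omega) h
  | succ j =>
    have hm : m * (j + 1) + (0 + m) ≤ 2 ^ j := by rw [pow_succ] at h; nlinarith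
    have hW : W j m (0 + m) := W.of_weight_le (by omega) hm
    exact ⟨m, m, 0, 0, rfl, rfl, hW, hW⟩

theorem pelc_even (n : ℕ) (hn : 2 ≤ n) (heven : Even n) :
    sInf {q : ℕ | W q n 0} = sInf {q : ℕ | n * (q + 1) ≤ 2 ^ q} := by
  simp only [W_zero_iff_of_even heven]
end

section
/- (Responder's halving strategy) Let j, a, b be natural numbers with w_{j+1}(a,b) > 2^(j+1), i.e., (j+2)·a + b > 2^(j+1). Then for every split a₁ + a₂ = a, b₁ + b₂ = b, at least one of the two successor states has weight exceeding 2^j: (j+1)·a₁ + (b₁ + a₂) > 2^j or (j+1)·a₂ + (b₂ + a₁) > 2^j. -/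
theorem responder_halving (j a b a₁ a₂ b₁ b₂ : ℕ)
    (hw : (j + 2) * a + b > 2 ^ (j + 1))
    (ha : a₁ + a₂ = a) (hb : b₁ + b₂ = b) :
    (j + 1) * a₁ + (b₁ + a₂) > 2 ^ j ∨ (j + 1) * a₂ + (b₂ + a₁) > 2 ^ j := by
  subst ha hb
  by_contra! h
  rw [pow_succ] at hw
  linarith [h.1, h.2]
end

section
/- (Binary search phase) Let ℓ and p be natural numbers. If W p 1 ℓ, then W (ℓ + p) (2^ℓ) 0: performing a binary search on the ℓ binary digits of the 2^ℓ candidates leads, after ℓ questions, to the state (1, ℓ), from which the questioner wins with p more questions. -/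
/-- Halving both parts of the state `(2 ^ m, k * 2 ^ m)` adds one to the ratio `k`, so that
`m` halvings lead to the state `(1, k + m)`. -/
theorem W_two_pow_mul_two_pow (p m k : ℕ) (h : W p 1 (k + m)) :
    W (m + p) (2 ^ m) (k * 2 ^ m) := by
  induction m generalizing k with
  | zero => simpa using h
  | succ m ih =>
    have hW : W (m + p) (2 ^ m) (k * 2 ^ m + 2 ^ m) := by
      rw [← Nat.succ_mul]
      exact ih (k + 1) (by rwa [Nat.add_right_comm])
    rw [Nat.add_right_comm]
    exact ⟨2 ^ m, 2 ^ m, k * 2 ^ m, k * 2 ^ m, by ring, by ring, hW, hW⟩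

theorem binary_search_phase (ℓ p : ℕ) (h : W p 1 ℓ) : W (ℓ + p) (2 ^ ℓ) 0 := by
  simpa using W_two_pow_mul_two_pow p ℓ 0 (by simpa using h)
end

section
/- (Endgame lemma) Let p ≥ 1 and r be natural numbers with p + 1 + r = 2^p. Then W p 1 r: from a state with one nonpenny and r pennies of total weight exactly 2^p, the questioner wins within p questions. -/
/-- A state consisting of at most `2 ^ j` pennies is won by repeated halving. -/
theorem W_zero_of_le_two_pow (j b : ℕ) (h : b ≤ 2 ^ j) : W j 0 b := by
  induction j generalizing b with
  | zero => simpa [W] using h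
  | succ j ih =>
    rw [pow_succ] at h
    exact ⟨0, 0, b / 2, b - b / 2, rfl, by omega, ih _ (by omega), ih _ (by omega)⟩

/-- One nonpenny and `r` pennies of total weight `2 ^ p` are won within `p` questions. -/
theorem W_one_of_weight_eq_two_pow (p r : ℕ) (h : p + 1 + r = 2 ^ p) : W p 1 r := by
  induction p generalizing r with
  | zero =>
    rw [pow_zero] at h
    simp only [W]
    omega
  | succ p ih =>
    have hlt : p < 2 ^ p := Nat.lt_two_pow_self
    rw [pow_succ] at h
    exact ⟨1, 0, 2 ^ p - (p + 1), 2 ^ p - 1, rfl, by omega, ih _ (by omega),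
      W_zero_of_le_two_pow _ _ (by omega)⟩

theorem endgame (p r : ℕ) (hp : 1 ≤ p) (h : p + 1 + r = 2 ^ p) : W p 1 r := by
  exact W_one_of_weight_eq_two_pow p r h
end

section
/- Let n ≥ 2 be a natural number, let ℓ be the least natural number with n ≤ 2^ℓ, and let q be the least natural number with 2^ℓ · (q + 1) ≤ 2^q. If q ≥ 4, then n · (q − 2) > 2^(q−3). -/
theorem two_from_optimal_arith (n ℓ q : ℕ) (hn : 2 ≤ n)
    (hℓ : IsLeast {m : ℕ | n ≤ 2 ^ m} ℓ)
    (hq : IsLeast {m : ℕ | 2 ^ ℓ * (m + 1) ≤ 2 ^ m} q)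
    (hq4 : 4 ≤ q) :
    n * (q - 2) > 2 ^ (q - 3) := by
  obtain ⟨k, rfl⟩ := Nat.exists_eq_add_of_le' hq4
  obtain _ | j := ℓ
  · have h : n ≤ 2 ^ 0 := hℓ.1
    omega
  have hj : 2 ^ j < n := by
    by_contra! h
    have := hℓ.2 h
    omega
  have hk : 2 ^ (k + 3) < 2 ^ (j + 1) * (k + 3 + 1) := by
    by_contra! h
    have := hq.2 h
    omega
  have hmul : 2 ^ j * (k + 4) ≤ n * (k + 4) := Nat.mul_le_mul_right _ hj.le
  have hnk : 0 ≤ n * k := Nat.zero_le _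
  change 2 ^ (k + 1) < n * (k + 2)
  simp only [pow_succ] at hk ⊢
  nlinarith
end
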